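/- arXiv:1808.10443 — 2 statements merged into one kernel-verified Lean document; each statement's English description precedes it below -/
import Mathlib

section
/- Let n, k be positive integers with n ≥ 4k + 6 and let G be a graph on n vertices with n even. Then mp(G) = n − k if and only if δ(G) = n − k. -/
open SimpleGraph

/-- An almost-perfect matching: a matching covering all vertices except exactly one. -/
def SimpleGraph.Subgraph.IsAlmostPerfectMatching {V : Type*} {G : SimpleGraph V}
    (M : G.Subgraph) : Prop :=
  M.IsMatching ∧ ∃ v : V, M.verts = {v}ᶜ

/-- `G` has a perfect matching or an almost-perfect matching. -/
def SimpleGraph.HasGoodMatching {V : Type*} (G : SimpleGraph V) : Prop :=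
  (∃ M : G.Subgraph, M.IsPerfectMatching) ∨ (∃ M : G.Subgraph, M.IsAlmostPerfectMatching)

/-- The matching preclusion number of `G`. -/
noncomputable def SimpleGraph.mp {V : Type*} [Fintype V] (G : SimpleGraph V) : ℕ :=
  sInf { k | ∃ F : Finset (Sym2 V), ↑F ⊆ G.edgeSet ∧ F.card = k ∧
    ¬ (G.deleteEdges ↑F).HasGoodMatching }

lemma mp_arith (n j a L s f : ℕ) (hn : 4 * j + 10 ≤ n) (hsum : a + L + s = n) (hs : s + 1 ≤ a)
    (ha : 2 ≤ a) (hf : f + 2 ≤ n) (h1 : a * L ≤ f + a * j)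
    (h2 : (a + L) * a ≤ 2 * f + (a + L) * j) : False := by
  zify at *
  rcases le_or_gt a L with h | h
  · have e1 : (a : ℤ) * (4 * j) ≤ a * (a + L + s - 10) :=
      mul_le_mul_of_nonneg_left (by linarith) (by linarith)
    have e2 : (a : ℤ) * s ≤ a * (a - 1) := mul_le_mul_of_nonneg_left (by linarith) (by linarith)
    have e3 : (3 * (a : ℤ) - 4) * a ≤ (3 * a - 4) * L :=
      mul_le_mul_of_nonneg_left (by linarith) (by linarith)
    nlinarith [sq_nonneg ((a : ℤ) - 1)]
  · have hL : (0 : ℤ) ≤ L := by positivity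
    have e1 : ((a : ℤ) + L) * (4 * j) ≤ (a + L) * (a + L + s - 10) :=
      mul_le_mul_of_nonneg_left (by linarith) (by linarith)
    have e2 : ((a : ℤ) + L) * s ≤ (a + L) * (a - 1) :=
      mul_le_mul_of_nonneg_left (by linarith) (by linarith)
    have e3 : (0 : ℤ) ≤ L * (a - L) := mul_nonneg hL (by linarith)
    nlinarith [sq_nonneg (2 * (a : ℤ) - 3)]

lemma mp_core {V C : Type*} [Fintype V] [DecidableEq V] [DecidableEq C] (G : SimpleGraph V)
    [DecidableRel G.Adj]
    (k : ℕ) (hk : 1 ≤ k) (hn : 4 * k + 6 ≤ Fintype.card V)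
    (hdeg : Fintype.card V - k ≤ G.minDegree) (F : Finset (Sym2 V)) (hF : F.card < G.minDegree)
    (M : Finset V) (col : V → C)
    (hcol : ∀ u ∈ M, ∀ v ∈ M, col u ≠ col v → G.Adj u v → s(u, v) ∈ F)
    (hc : Mᶜ.card + 2 ≤ (M.image col).card) : False := by
  have hnd : G.minDegree < Fintype.card V := by
    have : Nonempty V := Fintype.card_pos_iff.mp (by omega)
    exact G.minDegree_lt_card
  -- each vertex loses many edges
  have key : ∀ v ∈ M, ∀ T ⊆ M, (∀ w ∈ T, col v ≠ col w) →
      T.card ≤ (T.filter (fun w => s(v, w) ∈ F)).card + (k - 1) := by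
    intro v hv T hT hTc
    rw [← Finset.card_filter_add_card_filter_not (s := T) (fun w => s(v, w) ∈ F)]
    gcongr
    have hsub : T.filter (fun w => ¬ s(v, w) ∈ F) ⊆ (insert v (G.neighborFinset v))ᶜ := by
      intro w hw
      rw [Finset.mem_filter] at hw
      simp only [Finset.mem_compl, Finset.mem_insert, SimpleGraph.mem_neighborFinset, not_or]
      refine ⟨?_, fun h => hw.2 (hcol v hv w (hT hw.1) (hTc w hw.1) h)⟩
      rintro rfl
      exact hTc _ hw.1 rfl
    refine (Finset.card_le_card hsub).trans ?_
    rw [Finset.card_compl, Finset.card_insert_of_notMem (by simp), SimpleGraph.card_neighborFinset_eq_degree]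
    have := G.minDegree_le_degree v
    omega
  obtain ⟨c0, hc0, hmax⟩ := Finset.exists_max_image (M.image col)
    (fun c => (M.filter (fun w => col w = c)).card) (Finset.card_pos.mp (by omega))
  set B := M.filter (fun w => col w = c0) with hB
  set A := M.filter (fun w => ¬ col w = c0) with hA
  have hABM : A.card + B.card = M.card := by
    rw [add_comm]; exact Finset.card_filter_add_card_filter_not _
  have hMc : M.card + Mᶜ.card = Fintype.card V := Finset.card_add_card_compl M
  have hAs : Mᶜ.card + 1 ≤ A.card := by
    have h1 : (M.image col).erase c0 ⊆ A.image col := by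
      intro c hc
      rw [Finset.mem_erase, Finset.mem_image] at hc
      obtain ⟨h, w, hw, rfl⟩ := hc
      exact Finset.mem_image_of_mem _ (by simp [hA, hw, h])
    have h2 := (Finset.card_le_card h1).trans Finset.card_image_le
    rw [Finset.card_erase_of_mem hc0] at h2
    omega
  have b1 : A.card * B.card ≤ F.card + A.card * (k - 1) := by
    have hP : ((A ×ˢ B).filter (fun p => s(p.1, p.2) ∈ F)).card ≤ F.card := by
      refine Finset.card_le_card_of_injOn (fun p => s(p.1, p.2)) (fun p hp => (Finset.mem_filter.mp hp).2) ?_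
      rintro ⟨x, y⟩ hx ⟨z, w⟩ hz h
      simp only [hA, hB, Finset.coe_filter, Finset.mem_product, Finset.mem_filter, Set.mem_ofPred_eq] at hx hz
      simp only [Sym2.eq_iff] at h
      rcases h with ⟨rfl, rfl⟩ | ⟨rfl, rfl⟩
      · rfl
      · exact absurd hz.1.2.2 hx.1.1.2
    have hS : ((A ×ˢ B).filter (fun p => s(p.1, p.2) ∈ F)).card
        = ∑ v ∈ A, (B.filter (fun w => s(v, w) ∈ F)).card := by
      simp only [Finset.card_filter, Finset.sum_product]
    have := Finset.sum_le_sum (s := A) (f := fun _ => B.card)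
      (g := fun v => (B.filter (fun w => s(v, w) ∈ F)).card + (k - 1)) (by
        intro v hv
        rw [hA, Finset.mem_filter] at hv
        refine key v hv.1 B (Finset.filter_subset _ _) ?_
        intro w hw h
        rw [hB, Finset.mem_filter] at hw
        exact hv.2 (h.trans hw.2))
    rw [Finset.sum_add_distrib, ← hS, Finset.sum_const, Finset.sum_const] at this
    simp only [smul_eq_mul] at this
    omega
  have b2 : M.card * A.card ≤ 2 * F.card + M.card * (k - 1) := by
    set P := (M ×ˢ M).filter (fun p => col p.1 ≠ col p.2 ∧ s(p.1, p.2) ∈ F) with hPd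
    have hP : P.card ≤ 2 * F.card := by
      refine Finset.card_le_mul_card_image_of_maps_to (f := fun p : V × V => s(p.1, p.2))
        (fun p hp => (Finset.mem_filter.mp hp).2.2) 2 ?_
      intro e he
      induction e with
      | _ x y =>
      refine (Finset.card_le_card (t := {(x, y), (y, x)}) ?_).trans Finset.card_le_two
      rintro ⟨z, w⟩ h
      rw [Finset.mem_filter] at h
      have h := h.2
      simp only [Sym2.eq_iff] at h
      simp only [Finset.mem_insert, Finset.mem_singleton, Prod.mk.injEq]
      exact h
    have hS : P.card = ∑ v ∈ M, ((M.filter (fun w => col v ≠ col w)).filter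
        (fun w => s(v, w) ∈ F)).card := by
      simp only [hPd, Finset.filter_filter]
      simp only [Finset.card_filter, Finset.sum_product]
    have := Finset.sum_le_sum (s := M) (f := fun _ => A.card)
      (g := fun v => ((M.filter (fun w => col v ≠ col w)).filter
        (fun w => s(v, w) ∈ F)).card + (k - 1)) (by
        intro v hv
        refine le_trans ?_ (key v hv (M.filter (fun w => col v ≠ col w)) (Finset.filter_subset _ _)
          (fun w hw => (Finset.mem_filter.mp hw).2))
        have h1 := hmax (col v) (Finset.mem_image_of_mem _ hv)
        have h2 := Finset.card_filter_add_card_filter_not (s := M) (fun w => col w = col v)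
        have h3 : M.filter (fun w => col v ≠ col w) = M.filter (fun w => ¬ col w = col v) := by
          apply Finset.filter_congr
          intro w _
          exact ne_comm
        rw [h3]
        replace h1 : (M.filter (fun w => col w = col v)).card ≤ B.card := h1
        omega)
    rw [Finset.sum_add_distrib, ← hS, Finset.sum_const, Finset.sum_const] at this
    simp only [smul_eq_mul] at this
    omega
  by_cases ha : A.card = 1
  · have hM : Mᶜ = ∅ := Finset.card_eq_zero.mp (by omega)
    rw [Finset.compl_eq_empty_iff] at hM
    obtain ⟨v, hv⟩ := Finset.card_eq_one.mp ha
    have hvA : v ∈ A := by simp [hv]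
    have hv0 : col v ≠ c0 := (Finset.mem_filter.mp hvA).2
    have hle : (G.neighborFinset v).card ≤ F.card := by
      refine Finset.card_le_card_of_injOn (fun w => s(v, w)) ?_ ?_
      · intro w hw
        have hw : G.Adj v w := by simpa using hw
        refine hcol v (by simp [hM]) w (by simp [hM]) ?_ hw
        intro h
        have : w ∈ A := by simp [hA, hM, ← h, hv0]
        rw [hv, Finset.mem_singleton] at this
        exact hw.ne this.symm
      · intro x _ y _ h
        rcases Sym2.eq_iff.mp h with h | h
        · exact h.2
        · exact h.2.trans h.1
    rw [SimpleGraph.card_neighborFinset_eq_degree] at hle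
    have := G.minDegree_le_degree v
    omega
  · rw [← hABM] at b2
    exact mp_arith (Fintype.card V) (k - 1) A.card B.card Mᶜ.card F.card (by omega) (by omega)
      hAs (by omega) (by omega) b1 b2

lemma mp_lower {V : Type*} [Fintype V] (G : SimpleGraph V) [DecidableRel G.Adj]
    (k : ℕ) (hk : 1 ≤ k) (hn : 4 * k + 6 ≤ Fintype.card V) (he : Even (Fintype.card V))
    (hdeg : Fintype.card V - k ≤ G.minDegree) (F : Finset (Sym2 V))
    (hF : ¬ (G.deleteEdges (F : Set (Sym2 V))).HasGoodMatching) : G.minDegree ≤ F.card := by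
  classical
  by_contra hlt
  push Not at hlt
  have h1 : ¬ ∃ M : (G.deleteEdges (F : Set (Sym2 V))).Subgraph, M.IsPerfectMatching :=
    fun h => hF (Or.inl h)
  rw [SimpleGraph.tutte] at h1
  push Not at h1
  obtain ⟨u, hu⟩ := h1
  unfold SimpleGraph.IsTutteViolator at hu
  set G' := G.deleteEdges (F : Set (Sym2 V)) with hG'
  set W := ((⊤ : G'.Subgraph).deleteVerts u) with hW
  have hWv : ∀ v, v ∈ W.verts ↔ v ∉ u := by intro v; simp [hW]
  set M : Finset V := Finset.univ.filter (fun v => v ∈ W.verts) with hM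
  have hMu : Mᶜ.card = u.ncard := by
    rw [← Set.ncard_coe_finset]
    congr 1
    ext v
    simp [hM, hWv]
  have hWc : Nat.card W.verts = M.card := by
    rw [Nat.card_coe_set_eq, ← Set.ncard_coe_finset]
    congr 1
    ext v
    simp [hM]
  have hpar := W.coe.odd_ncard_oddComponents
  have hMc : M.card + Mᶜ.card = Fintype.card V := Finset.card_add_card_compl M
  have hodd2 : u.ncard + 2 ≤ W.coe.oddComponents.ncard := by
    rw [hWc] at hpar
    rw [← hMu] at hu ⊢
    rw [Nat.odd_iff, Nat.odd_iff] at hpar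
    rw [Nat.even_iff] at he
    omega
  let col : V → Option W.coe.ConnectedComponent := fun v =>
    if h : v ∈ W.verts then some (W.coe.connectedComponentMk ⟨v, h⟩) else none
  refine mp_core G k hk hn hdeg F hlt M col ?_ ?_
  · intro x hx y hy hxy hadj
    by_contra hnF
    have hx' : x ∈ W.verts := by simpa [hM] using hx
    have hy' : y ∈ W.verts := by simpa [hM] using hy
    apply hxy
    simp only [col, hx', hy', dif_pos]
    congr 1
    rw [SimpleGraph.ConnectedComponent.eq]
    apply SimpleGraph.Adj.reachable
    have a1 := (hWv x).1 hx'
    have a2 := (hWv y).1 hy'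
    simp [hW, hG', a1, a2, hadj, hnF]
  · rw [hMu]
    refine hodd2.trans ?_
    rw [← Set.ncard_coe_finset]
    refine Set.ncard_le_ncard_of_injOn some ?_ (Option.some_injective _).injOn (Finset.finite_toSet _)
    intro c _
    induction c using SimpleGraph.ConnectedComponent.ind with
    | _ w =>
    rw [Finset.coe_image]
    refine ⟨w.1, by simp [hM], ?_⟩
    simp [col]

lemma mp_isolate {V : Type*} [Fintype V] (G : SimpleGraph V) [DecidableRel G.Adj]
    (hn : 0 < Fintype.card V) (he : Even (Fintype.card V)) :
    ∃ F : Finset (Sym2 V), ↑F ⊆ G.edgeSet ∧ F.card = G.minDegree ∧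
      ¬ (G.deleteEdges (F : Set (Sym2 V))).HasGoodMatching := by
  classical
  have : Nonempty V := Fintype.card_pos_iff.mp hn
  obtain ⟨v, hv⟩ := G.exists_minimal_degree_vertex
  refine ⟨G.incidenceFinset v, ?_, ?_, ?_⟩
  · intro e he
    rw [Finset.mem_coe, SimpleGraph.mem_incidenceFinset] at he
    exact he.1
  · rw [SimpleGraph.card_incidenceFinset_eq_degree, hv]
  · rintro (⟨M, hM⟩ | ⟨M, hM, w, hw⟩)
    · obtain ⟨w, hw, -⟩ := hM.1 (hM.2 v)
      have := M.adj_sub hw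
      rw [SimpleGraph.deleteEdges_adj] at this
      apply this.2
      rw [Finset.mem_coe, SimpleGraph.mem_incidenceFinset]
      exact ⟨this.1, by simp⟩
    · have := hM.even_card
      have h2 : M.verts.toFinset.card = Fintype.card V - 1 := by
        have : M.verts.toFinset = {w}ᶜ := by ext x; simp [hw]
        rw [this, Finset.card_compl, Finset.card_singleton]
      rw [h2, Nat.even_iff] at this
      rw [Nat.even_iff] at he
      omega

theorem stmt10 {V : Type*} [Fintype V] (G : SimpleGraph V) [DecidableRel G.Adj]
    (k : ℕ) (hk : 1 ≤ k) (hn : 4 * k + 6 ≤ Fintype.card V) (he : Even (Fintype.card V)) :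
    G.mp = Fintype.card V - k ↔ G.minDegree = Fintype.card V - k := by
  obtain ⟨F, hFs, hFc, hFm⟩ := mp_isolate G (by omega) he
  have hup : G.mp ≤ G.minDegree := Nat.sInf_le ⟨F, hFs, hFc, hFm⟩
  have hlow : Fintype.card V - k ≤ G.minDegree → G.minDegree ≤ G.mp := by
    intro h
    refine le_csInf ⟨_, F, hFs, hFc, hFm⟩ ?_
    rintro b ⟨F', -, rfl, hF'⟩
    exact mp_lower G k hk hn he h F' hF'
  constructor
  · intro h
    have := hlow (by omega)
    omega
  · intro h
    have := hlow (by omega)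
    omega
end

section
/- Let G be a graph with an odd number n ≥ 9 of vertices. Then mp(G) = 2n − 4 if and only if G = K_n − e for some edge e of K_n. -/
open SimpleGraph

open Finset in
/-- Tutte's theorem with parity, in terms of representatives of odd components. -/
theorem tutte_reps {W : Type*} [Fintype W] [DecidableEq W] (H : SimpleGraph W)
    (he : Even (Fintype.card W)) (hno : ¬ ∃ M : H.Subgraph, M.IsPerfectMatching) :
    ∃ S R : Finset W, Disjoint S R ∧ R.card = S.card + 2 ∧
      (∀ a ∈ R, ∀ b ∈ R, ¬ H.Adj a b) ∧
      (∀ w, w ∉ S → ∀ a ∈ R, ∀ b ∈ R, H.Adj w a → H.Adj w b → a = b) := by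
  classical
  rw [SimpleGraph.tutte] at hno
  push Not at hno
  obtain ⟨u, hu⟩ := hno
  unfold IsTutteViolator at hu
  set K := ((⊤ : H.Subgraph).deleteVerts u).coe with hK
  have hpar := odd_ncard_oddComponents K
  have hcard : Nat.card ((⊤ : H.Subgraph).deleteVerts u).verts + u.ncard = Fintype.card W := by
    have h1 : ((⊤ : H.Subgraph).deleteVerts u).verts = uᶜ := by
      ext; simp
    rw [h1, Nat.card_coe_set_eq, add_comm, Set.ncard_add_ncard_compl, Nat.card_eq_fintype_card]
  have hq : u.ncard + 2 ≤ K.oddComponents.ncard := by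
    by_contra hlt
    have heq : K.oddComponents.ncard = u.ncard + 1 := by omega
    rw [heq] at hpar
    rw [← hcard] at he
    rw [Nat.even_add] at he
    rw [Nat.odd_add_one, Nat.not_odd_iff_even, ← he, ← Nat.not_even_iff_odd] at hpar
    tauto
  have hq' : u.ncard + 2 ≤ (Set.toFinite K.oddComponents).toFinset.card := by
    rwa [← Set.ncard_eq_toFinset_card]
  obtain ⟨t, -, ht⟩ := Finset.exists_subset_card_eq hq'
  let f : K.ConnectedComponent → W := fun c => (Quot.out c).val
  have hf : ∀ c : K.ConnectedComponent, K.connectedComponentMk (Quot.out c) = c := fun c => Quot.out_eq c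
  have hinj : Function.Injective f := by
    intro c d hcd
    have : Quot.out c = Quot.out d := Subtype.ext hcd
    rw [← hf c, ← hf d, this]
  have hfu : ∀ c, f c ∉ u := fun c => by
    have := (Quot.out c).2
    simpa using this
  have hadj : ∀ (x y : ((⊤ : H.Subgraph).deleteVerts u).verts), H.Adj x y →
      K.connectedComponentMk x = K.connectedComponentMk y := by
    intro x y hxy
    apply SimpleGraph.ConnectedComponent.sound
    apply SimpleGraph.Adj.reachable
    have hx := x.2
    have hy := y.2
    simp only [Subgraph.deleteVerts_verts, Subgraph.verts_top, Set.mem_sdiff, Set.mem_univ,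
      true_and] at hx hy
    simp [hK, Subgraph.deleteVerts_adj, hx, hy, hxy]
  refine ⟨(Set.toFinite u).toFinset, t.image f, ?_, ?_, ?_, ?_⟩
  · rw [Finset.disjoint_right]
    intro a ha
    obtain ⟨c, -, rfl⟩ := Finset.mem_image.1 ha
    simpa using hfu c
  · rw [Finset.card_image_of_injective _ hinj, ht, Set.ncard_eq_toFinset_card]
  · intro a ha b hb hab
    obtain ⟨c, -, rfl⟩ := Finset.mem_image.1 ha
    obtain ⟨d, -, rfl⟩ := Finset.mem_image.1 hb
    have := (hf c).symm.trans ((hadj _ _ hab).trans (hf d))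
    subst this
    exact H.loopless.irrefl _ hab
  · intro w hw a ha b hb hwa hwb
    obtain ⟨c, -, rfl⟩ := Finset.mem_image.1 ha
    obtain ⟨d, -, rfl⟩ := Finset.mem_image.1 hb
    have hw' : w ∈ ((⊤ : H.Subgraph).deleteVerts u).verts := by simpa using hw
    have h1 := hadj ⟨w, hw'⟩ (Quot.out c) hwa
    have h2 := hadj ⟨w, hw'⟩ (Quot.out d) hwb
    have h3 : c = d := (hf c).symm.trans (h1.symm.trans (h2.trans (hf d)))
    rw [h3]

/-- `H` with an additional universal vertex. -/
def coneGraph {V : Type*} (H : SimpleGraph V) : SimpleGraph (Option V) where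
  Adj x y := match x, y with
    | some a, some b => H.Adj a b
    | none, none => False
    | _, _ => True
  symm := ⟨by
    rintro (_ | a) (_ | b) h
    · exact h
    · trivial
    · trivial
    · exact SimpleGraph.Adj.symm (G := H) h⟩
  loopless := ⟨by
    rintro (_ | a) h
    · exact h
    · exact H.loopless.irrefl a h⟩

theorem almost_of_cone {V : Type*} (H : SimpleGraph V)
    (h : ∃ M : (coneGraph H).Subgraph, M.IsPerfectMatching) : H.HasGoodMatching := by
  obtain ⟨M, hM, hs⟩ := h
  right
  have hM' : ∀ x, ∃! y, M.Adj x y := fun x => hM (hs x)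
  obtain ⟨p, hp, hpu⟩ := hM' none
  cases p with
  | none => exact absurd hp (M.loopless.irrefl _)
  | some v0 =>
  refine ⟨{ verts := {v0}ᶜ
            Adj := fun a b => M.Adj (some a) (some b)
            adj_sub := fun {a b} hab => M.adj_sub hab
            edge_vert := ?_
            symm := ⟨fun a b hab => M.adj_symm hab⟩ }, ?_, v0, rfl⟩
  · intro a b hab
    simp only [Set.mem_compl_iff, Set.mem_singleton_iff]
    rintro rfl
    have := (hM' (some a)).unique hab (M.adj_symm hp)
    simp at this
  · intro a ha
    obtain ⟨q, hq, hqu⟩ := hM' (some a)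
    cases q with
    | none =>
      have := hpu _ (M.adj_symm hq)
      simp at this
      exact absurd this ha
    | some b =>
      exact ⟨b, hq, fun c hc => Option.some_injective _ (hqu _ hc)⟩

theorem berge_reps {V : Type*} [Fintype V] [DecidableEq V] (H : SimpleGraph V)
    (ho : Odd (Fintype.card V)) (hno : ¬ H.HasGoodMatching) :
    ∃ S R : Finset V, Disjoint S R ∧ R.card = S.card + 3 ∧
      (∀ a ∈ R, ∀ b ∈ R, ¬ H.Adj a b) ∧
      (∀ w, w ∉ S → ∀ a ∈ R, ∀ b ∈ R, H.Adj w a → H.Adj w b → a = b) := by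
  obtain ⟨S, R, hd, hc, h1, h2⟩ := tutte_reps (coneGraph H)
    (by rw [Fintype.card_option]; exact ho.add_one) (fun h => hno (almost_of_cone H h))
  have hnone : ∀ a : V, (coneGraph H).Adj none (some a) := fun a => trivial
  have hR2 : 1 < R.card := by omega
  obtain ⟨a, ha, b, hb, hab⟩ := Finset.one_lt_card.1 hR2
  have hnR : none ∉ R := by
    intro hn
    obtain ⟨c, hcR, hcn⟩ := Finset.exists_mem_ne hR2 none
    cases c with
    | none => exact hcn rfl
    | some c => exact h1 _ hn _ hcR (hnone c)
  have hnS : none ∈ S := by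
    by_contra hn
    cases a with
    | none => exact hnR ha
    | some a =>
    cases b with
    | none => exact hnR hb
    | some b => exact hab (h2 _ hn _ ha _ hb (hnone a) (hnone b))
  refine ⟨S.eraseNone, R.eraseNone, ?_, ?_, ?_, ?_⟩
  · rw [Finset.disjoint_left] at hd ⊢
    intro x hx hx'
    exact hd (Finset.mem_eraseNone.1 hx) (Finset.mem_eraseNone.1 hx')
  · have e1 := Finset.card_eraseNone_eq_card_erase S
    have e2 := Finset.card_eraseNone_eq_card_erase R
    rw [Finset.erase_eq_of_notMem hnR] at e2
    rw [Finset.card_erase_of_mem hnS] at e1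
    have : 0 < S.card := Finset.card_pos.2 ⟨_, hnS⟩
    omega
  · intro a ha b hb hab
    exact h1 _ (Finset.mem_eraseNone.1 ha) _ (Finset.mem_eraseNone.1 hb) hab
  · intro w hw a ha b hb hwa hwb
    exact Option.some_injective _ (h2 (some w) (fun h => hw (Finset.mem_eraseNone.2 h)) _
      (Finset.mem_eraseNone.1 ha) _ (Finset.mem_eraseNone.1 hb) hwa hwb)

open Finset in
theorem compl_edges_bound {V : Type*} [Fintype V] [DecidableEq V] (H : SimpleGraph V)
    [DecidableRel H.Adj]
    (ho : Odd (Fintype.card V)) (h9 : 9 ≤ Fintype.card V) (hno : ¬ H.HasGoodMatching) :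
    2 * Fintype.card V ≤ Hᶜ.edgeFinset.card + 3 := by
  obtain ⟨S, R, hd, hc, h1, h2⟩ := berge_reps H ho hno
  set T := (S ∪ R)ᶜ with hT
  have hcardT : T.card + (S.card + R.card) = Fintype.card V := by
    rw [← card_union_of_disjoint hd, hT, card_compl_add_card]
  have hdTR : Disjoint R T := by
    rw [Finset.disjoint_left]; intro x hx; simp [hT, hx]
  have hdeg := Hᶜ.sum_degrees_eq_twice_card_edges
  -- number of non-neighbours in `R` of a vertex in `T`
  have hTb : ∀ w ∈ T, R.card - 1 ≤ (R.filter (fun r => Hᶜ.Adj r w)).card := by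
    intro w hw
    have hwS : w ∉ S := fun h => by simp [hT, h] at hw
    have hwR : w ∉ R := fun h => by simp [hT, h] at hw
    have hsplit := card_filter_add_card_filter_not (s := R) (fun r => Hᶜ.Adj r w)
    have : (R.filter (fun r => ¬ Hᶜ.Adj r w)).card ≤ 1 := by
      rw [card_le_one]
      intro a ha b hb
      rw [mem_filter, compl_adj] at ha hb
      have ha' : H.Adj w a := by
        by_contra h
        exact ha.2 ⟨fun e => hwR (e ▸ ha.1), fun h' => h h'.symm⟩
      have hb' : H.Adj w b := by
        by_contra h
        exact hb.2 ⟨fun e => hwR (e ▸ hb.1), fun h' => h h'.symm⟩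
      exact h2 w hwS a ha.1 b hb.1 ha' hb'
    omega
  have hTd : ∀ w ∈ T, R.card - 1 ≤ Hᶜ.degree w := by
    intro w hw
    refine (hTb w hw).trans (card_le_card ?_)
    intro r hr
    rw [mem_neighborFinset]
    exact (mem_filter.1 hr).2.symm
  have hRd : ∀ r ∈ R, R.card - 1 + (T.filter (fun w => Hᶜ.Adj r w)).card ≤ Hᶜ.degree r := by
    intro r hr
    rw [← card_erase_of_mem hr, ← card_union_of_disjoint]
    · apply card_le_card
      intro x hx
      rw [mem_neighborFinset]
      rcases mem_union.1 hx with hx | hx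
      · rw [mem_erase] at hx
        exact ⟨fun e => hx.1 e.symm, h1 r hr x hx.2⟩
      · exact (mem_filter.1 hx).2
    · exact (hdTR.mono_left (erase_subset _ _)).mono_right (filter_subset _ _)
  have hdc : ∑ r ∈ R, (T.filter (fun w => Hᶜ.Adj r w)).card
      = ∑ w ∈ T, (R.filter (fun r => Hᶜ.Adj r w)).card :=
    sum_card_bipartiteAbove_eq_sum_card_bipartiteBelow (fun r w => Hᶜ.Adj r w)
  have s1 : T.card * (R.card - 1) ≤ ∑ w ∈ T, (R.filter (fun r => Hᶜ.Adj r w)).card := by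
    simpa using sum_le_sum hTb
  have s2 : T.card * (R.card - 1) ≤ ∑ w ∈ T, Hᶜ.degree w := by
    simpa using sum_le_sum hTd
  have s3 := sum_le_sum hRd
  rw [sum_add_distrib, hdc, sum_const, smul_eq_mul] at s3
  have s4 : ∑ r ∈ R, Hᶜ.degree r + ∑ w ∈ T, Hᶜ.degree w ≤ ∑ v, Hᶜ.degree v := by
    rw [← sum_union hdTR]
    exact sum_le_sum_of_subset (subset_univ _)
  rw [hdeg] at s4
  obtain ⟨t, ht⟩ : ∃ t, t = T.card := ⟨_, rfl⟩
  obtain ⟨s, hs⟩ : ∃ s, s = S.card := ⟨_, rfl⟩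
  have hR1 : R.card - 1 = s + 2 := by omega
  have hR : R.card = s + 3 := by omega
  rw [hR1, ← ht] at s1 s2
  rw [hR1, hR] at s3
  have key : 2 * (t * (s + 2)) + (s + 3) * (s + 2) ≤ 2 * Hᶜ.edgeFinset.card := by omega
  have hn : Fintype.card V = t + 2 * s + 3 := by omega
  rw [hn]
  have hn9 : 6 ≤ t + 2 * s := by omega
  have hgoal : 0 ≤ (s : ℤ) * (2 * t + s - 3) := by
    rcases Nat.eq_zero_or_pos s with h | h
    · simp [h]
    · apply mul_nonneg (by positivity)
      omega
  zify at key ⊢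
  nlinarith

theorem lower_bound {V : Type*} [Fintype V] [DecidableEq V] (G : SimpleGraph V)
    (ho : Odd (Fintype.card V)) (h9 : 9 ≤ Fintype.card V) (C : Finset (Sym2 V))
    (hC : ∀ a b, a ≠ b → ¬ G.Adj a b → s(a, b) ∈ C) :
    2 * Fintype.card V ≤ G.mp + C.card + 3 := by
  classical
  have hne : { k | ∃ F : Finset (Sym2 V), ↑F ⊆ G.edgeSet ∧ F.card = k ∧
      ¬ (G.deleteEdges ↑F).HasGoodMatching }.Nonempty := by
    refine ⟨_, G.edgeFinset, by simp, rfl, ?_⟩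
    rintro (⟨M, hM, hs⟩ | ⟨M, hM, v, hv⟩)
    · obtain ⟨v⟩ : Nonempty V := Fintype.card_pos_iff.1 (by omega)
      obtain ⟨w, hw, -⟩ := hM (hs v)
      have := M.adj_sub hw
      simp at this
    · obtain ⟨w, hw⟩ := Fintype.exists_ne_of_one_lt_card (by omega : 1 < Fintype.card V) v
      obtain ⟨x, hx, -⟩ := hM (show w ∈ M.verts by rw [hv]; exact hw)
      have := M.adj_sub hx
      simp at this
  obtain ⟨F, hF, hcard, hbad⟩ := Nat.sInf_mem hne
  have hb := compl_edges_bound _ ho h9 hbad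
  have hsub : (G.deleteEdges (↑F : Set (Sym2 V)))ᶜ.edgeFinset ⊆ F ∪ C := by
    intro e he
    induction e using Sym2.ind with
    | _ a b =>
    rw [mem_edgeFinset, mem_edgeSet, compl_adj, deleteEdges_adj] at he
    rw [Finset.mem_union]
    by_cases hG : G.Adj a b
    · left
      by_contra h
      exact he.2 ⟨hG, by simpa using h⟩
    · right
      exact hC a b he.1 hG
  have h1 := (Finset.card_le_card hsub).trans (Finset.card_union_le _ _)
  have : G.mp = F.card := hcard.symm
  omega

theorem upper_bound {V : Type*} [Fintype V] [DecidableEq V] (G : SimpleGraph V)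
    (u v : V) (huv : u ≠ v) (A B : Finset V) (hA : ∀ x, G.Adj u x → x ∈ A)
    (hB : ∀ x, G.Adj v x → x = u ∨ x ∈ B) :
    G.mp ≤ A.card + B.card := by
  classical
  let F := G.edgeFinset.filter (fun e => u ∈ e ∨ v ∈ e)
  have hF : F ⊆ A.image (fun x => s(u, x)) ∪ B.image (fun x => s(v, x)) := by
    have key : ∀ a b, G.Adj a b → (u = a ∨ v = a) →
        s(a, b) ∈ A.image (fun x => s(u, x)) ∪ B.image (fun x => s(v, x)) := by
      intro a b hab h
      rw [Finset.mem_union, Finset.mem_image, Finset.mem_image]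
      rcases h with rfl | rfl
      · exact Or.inl ⟨b, hA b hab, rfl⟩
      · rcases hB b hab with rfl | hb
        · exact Or.inl ⟨v, hA v hab.symm, Sym2.eq_swap⟩
        · exact Or.inr ⟨b, hb, rfl⟩
    intro e he
    induction e using Sym2.ind with
    | _ a b =>
    simp only [F, Finset.mem_filter, mem_edgeFinset, mem_edgeSet, Sym2.mem_iff] at he
    obtain ⟨hab, h⟩ := he
    by_cases h' : u = a ∨ v = a
    · exact key a b hab h'
    · rw [Sym2.eq_swap]
      exact key b a hab.symm (by tauto)
  have hcard : F.card ≤ A.card + B.card :=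
    (Finset.card_le_card hF).trans ((Finset.card_union_le _ _).trans
      (add_le_add Finset.card_image_le Finset.card_image_le))
  refine le_trans (Nat.sInf_le ⟨F, ?_, rfl, ?_⟩) hcard
  · intro e he
    have := (Finset.mem_filter.1 he).1
    simpa using this
  · have hu : ∀ x, ¬ (G.deleteEdges (↑F : Set (Sym2 V))).Adj u x := by
      intro x hx
      rw [deleteEdges_adj] at hx
      exact hx.2 (by simp [F, hx.1])
    have hv : ∀ x, ¬ (G.deleteEdges (↑F : Set (Sym2 V))).Adj v x := by
      intro x hx
      rw [deleteEdges_adj] at hx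
      exact hx.2 (by simp [F, hx.1])
    rintro (⟨M, hM, hs⟩ | ⟨M, hM, w, hw⟩)
    · obtain ⟨x, hx, -⟩ := hM (hs u)
      exact hu _ (M.adj_sub hx)
    · by_cases h : u = w
      · obtain ⟨x, hx, -⟩ := hM (show v ∈ M.verts by
          rw [hw]; intro h'; exact huv (h.trans h'.symm))
        exact hv _ (M.adj_sub hx)
      · obtain ⟨x, hx, -⟩ := hM (show u ∈ M.verts by rw [hw]; exact h)
        exact hu _ (M.adj_sub hx)

theorem card_compl_pair {V : Type*} [Fintype V] [DecidableEq V] {a b : V} (h : a ≠ b) :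
    (({a, b} : Finset V)ᶜ).card = Fintype.card V - 2 := by
  rw [Finset.card_compl, Finset.card_pair h]

theorem card_compl_triple {V : Type*} [Fintype V] [DecidableEq V] {a b c : V} (h : a ≠ b)
    (h' : a ≠ c) (h'' : b ≠ c) :
    (({a, b, c} : Finset V)ᶜ).card = Fintype.card V - 3 := by
  rw [Finset.card_compl, Finset.card_eq_three.2 ⟨a, b, c, h, h', h'', rfl⟩]

theorem shared_bound {V : Type*} [Fintype V] [DecidableEq V] (G : SimpleGraph V)
    {u x w : V} (hux : u ≠ x) (huw : u ≠ w) (hxw : x ≠ w) (h1 : ¬ G.Adj u x)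
    (h2 : ¬ G.Adj u w) : G.mp ≤ Fintype.card V - 3 + (Fintype.card V - 2) := by
  rw [← card_compl_triple hux huw hxw, ← card_compl_pair hux]
  have hA : ∀ y, G.Adj u y → y ∈ ({u, x, w} : Finset V)ᶜ := by
    intro y hy
    simp only [Finset.mem_compl, Finset.mem_insert, Finset.mem_singleton, not_or]
    exact ⟨hy.ne', fun e => h1 (e ▸ hy), fun e => h2 (e ▸ hy)⟩
  refine upper_bound G u x hux _ _ hA ?_
  intro y hy
  right
  simp only [Finset.mem_compl, Finset.mem_insert, Finset.mem_singleton, not_or]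
  exact ⟨fun e => h1 (e ▸ hy.symm), hy.ne'⟩

theorem disjoint_bound {V : Type*} [Fintype V] [DecidableEq V] (G : SimpleGraph V)
    {a b c d : V} (hab : a ≠ b) (hcd : c ≠ d) (hca : c ≠ a) (hda : d ≠ a)
    (h1 : ¬ G.Adj a b) (h2 : ¬ G.Adj c d) :
    G.mp ≤ Fintype.card V - 2 + (Fintype.card V - 3) := by
  rw [← card_compl_triple hcd hca hda, ← card_compl_pair hab]
  have hA : ∀ y, G.Adj a y → y ∈ ({a, b} : Finset V)ᶜ := by
    intro y hy
    simp only [Finset.mem_compl, Finset.mem_insert, Finset.mem_singleton, not_or]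
    exact ⟨hy.ne', fun e => h1 (e ▸ hy)⟩
  refine upper_bound G a c hca.symm _ _ hA ?_
  intro y hy
  by_cases hya : y = a
  · exact Or.inl hya
  right
  simp only [Finset.mem_compl, Finset.mem_insert, Finset.mem_singleton, not_or]
  exact ⟨hy.ne', fun e => h2 (e ▸ hy), hya⟩

theorem stmt12 {V : Type*} [Fintype V] (G : SimpleGraph V)
    (hn : Odd (Fintype.card V)) (h9 : 9 ≤ Fintype.card V) :
    G.mp = 2 * Fintype.card V - 4 ↔
      ∃ u v : V, u ≠ v ∧ G = (⊤ : SimpleGraph V).deleteEdges {s(u, v)} := by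
  classical
  constructor
  · intro hmp
    by_cases hex : ∃ a b : V, a ≠ b ∧ ¬ G.Adj a b
    · obtain ⟨a, b, hab, hG⟩ := hex
      have hG' : ¬ G.Adj b a := fun h => hG h.symm
      refine ⟨a, b, hab, ?_⟩
      ext c d
      rw [deleteEdges_adj, top_adj, Set.mem_singleton_iff]
      constructor
      · intro h
        refine ⟨h.ne, fun e => hG ?_⟩
        rw [← mem_edgeSet, e] at h
        exact h
      · rintro ⟨hcd, hne⟩
        by_contra hN
        have hN' : ¬ G.Adj d c := fun h => hN h.symm
        by_cases hca : c = a
        · subst hca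
          have := shared_bound G hab hcd (fun e => hne (by rw [e])) hG hN
          omega
        by_cases hda : d = a
        · subst hda
          have := shared_bound G hab hcd.symm
            (fun e => hne (by rw [e, Sym2.eq_swap])) hG hN'
          omega
        have := disjoint_bound G hab hcd hca hda hG hN
        omega
    · push Not at hex
      have := lower_bound G hn h9 ∅ (fun a b h h' => absurd (hex a b h) h')
      simp at this
      omega
  · rintro ⟨u, v, huv, rfl⟩
    have hl := lower_bound ((⊤ : SimpleGraph V).deleteEdges {s(u, v)}) hn h9 {s(u, v)} (by
      intro a b hab h
      rw [deleteEdges_adj, top_adj, Set.mem_singleton_iff] at h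
      rw [Finset.mem_singleton]
      by_contra h'
      exact h ⟨hab, h'⟩)
    rw [Finset.card_singleton] at hl
    have hA : ∀ x, ((⊤ : SimpleGraph V).deleteEdges {s(u, v)}).Adj u x →
        x ∈ ({u, v} : Finset V)ᶜ := by
      intro x hx
      rw [deleteEdges_adj, top_adj, Set.mem_singleton_iff] at hx
      simp only [Finset.mem_compl, Finset.mem_insert, Finset.mem_singleton, not_or]
      exact ⟨fun e => hx.1 e.symm, fun e => hx.2 (by rw [e])⟩
    have hu := upper_bound _ u v huv _ ({u, v} : Finset V)ᶜ hA (by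
      intro x hx
      by_cases hxu : x = u
      · exact Or.inl hxu
      right
      simp only [Finset.mem_compl, Finset.mem_insert, Finset.mem_singleton, not_or]
      exact ⟨hxu, hx.ne'⟩)
    rw [card_compl_pair huv] at hu
    omega
end
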